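/- arXiv:2007.01442 — 2 statements merged into one kernel-verified Lean document; each statement's English description precedes it below -/
import Mathlib

section
/- Let b > 1 and c > 0 be real numbers. Then ∫_{1}^{∞} b^{2x+1}·exp( −c·b^{(x−1)/2} ) dx ≤ 12·b³ / (c⁴·log b). -/
theorem hasDerivAt_neg_cubic_mul_exp_neg (v : ℝ) :
    HasDerivAt (fun v : ℝ => -((v ^ 3 + 3 * v ^ 2 + 6 * v + 6) * Real.exp (-v)))
      (v ^ 3 * Real.exp (-v)) v := by
  have hp : HasDerivAt (fun v : ℝ => v ^ 3 + 3 * v ^ 2 + 6 * v + 6)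
      (3 * v ^ 2 + 3 * (2 * v) + 6) v := by
    have := ((((hasDerivAt_id' v).fun_pow 3).fun_add
      (((hasDerivAt_id' v).fun_pow 2).const_mul 3)).fun_add
        ((hasDerivAt_id' v).const_mul 6)).add_const 6
    exact this.congr_deriv (by norm_num)
  exact (hp.fun_mul (hasDerivAt_neg v).exp).fun_neg.congr_deriv (by ring)

theorem tendsto_neg_cubic_mul_exp_neg_atTop :
    Filter.Tendsto (fun v : ℝ => -((v ^ 3 + 3 * v ^ 2 + 6 * v + 6) * Real.exp (-v)))
      Filter.atTop (nhds 0) := by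
  have h := Real.tendsto_pow_mul_exp_neg_atTop_nhds_zero
  convert ((((h 3).add ((h 2).const_mul 3)).add ((h 1).const_mul 6)).add
    ((h 0).const_mul 6)).neg using 2
  · ring
  · norm_num

theorem cubic_mul_exp_neg_le_six {c : ℝ} (hc : 0 ≤ c) :
    (c ^ 3 + 3 * c ^ 2 + 6 * c + 6) * Real.exp (-c) ≤ 6 := by
  have h := Real.sum_le_exp_of_nonneg hc 4
  norm_num [Finset.sum_range_succ, Nat.factorial] at h
  rw [Real.exp_neg, ← div_eq_mul_inv, div_le_iff₀ (Real.exp_pos c)]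
  linarith

/-- Key integral estimate of Proposition 3:
`∫_{1}^{∞} b^{2x+1}·exp(−c·b^{(x−1)/2}) dx ≤ 12 b³/(c⁴ log b)` for `b > 1`, `c > 0`. -/
theorem stmt14 (b c : ℝ) (hb : 1 < b) (hc : 0 < c) :
    ∫ x in Set.Ioi (1 : ℝ), b ^ (2 * x + 1) * Real.exp (-c * b ^ ((x - 1) / 2)) ≤
      12 * b ^ 3 / (c ^ 4 * Real.log b) := by
  have hb0 : 0 < b := by linarith
  have hlog : 0 < Real.log b := Real.log_pos hb
  set v : ℝ → ℝ := fun x => c * b ^ ((x - 1) / 2) with hv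
  set F : ℝ → ℝ := fun v => -((v ^ 3 + 3 * v ^ 2 + 6 * v + 6) * Real.exp (-v)) with hF
  set K : ℝ := 2 * b ^ 3 / (c ^ 4 * Real.log b) with hK
  have hv_deriv (x : ℝ) : HasDerivAt v (v x * (Real.log b / 2)) x := by
    have hlin : HasDerivAt (fun x : ℝ => (x - 1) / 2) (1 / 2) x :=
      ((hasDerivAt_id' x).sub_const 1).div_const 2
    exact ((hlin.const_rpow hb0).const_mul c).congr_deriv (by simp only [hv]; ring)
  have hv_top : Filter.Tendsto v Filter.atTop Filter.atTop := by
    refine Filter.Tendsto.const_mul_atTop hc ?_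
    refine (tendsto_rpow_atTop_of_base_gt_one b hb).comp ?_
    exact (Filter.tendsto_atTop_add_const_right _ (-1) Filter.tendsto_id).atTop_div_const two_pos
  have hpow (x : ℝ) : b ^ (2 * x + 1) = b ^ 3 * (b ^ ((x - 1) / 2)) ^ 4 := by
    rw [← Real.rpow_natCast (b ^ ((x - 1) / 2)), ← Real.rpow_mul hb0.le,
      ← Real.rpow_natCast b 3, ← Real.rpow_add hb0]
    congr 1
    push_cast
    ring
  have hderiv (x : ℝ) : HasDerivAt (fun x => K * F (v x))
      (b ^ (2 * x + 1) * Real.exp (-c * b ^ ((x - 1) / 2))) x := by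
    refine (((hasDerivAt_neg_cubic_mul_exp_neg (v x)).comp x
      (hv_deriv x)).const_mul K).congr_deriv ?_
    simp only [hpow, hv, hK, neg_mul]
    field_simp
  have hlim : Filter.Tendsto (fun x => K * F (v x)) Filter.atTop (nhds 0) := by
    rw [← mul_zero K]
    exact (tendsto_neg_cubic_mul_exp_neg_atTop.comp hv_top).const_mul K
  rw [MeasureTheory.integral_Ioi_of_hasDerivAt_of_nonneg' (fun x _ => hderiv x)
    (fun x _ => by positivity) hlim]
  have hv1 : v 1 = c := by simp [hv]
  have hK0 : 0 ≤ K := by positivity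
  calc 0 - K * F (v 1) = K * ((c ^ 3 + 3 * c ^ 2 + 6 * c + 6) * Real.exp (-c)) := by
        rw [hv1]; ring
    _ ≤ K * 6 := mul_le_mul_of_nonneg_left (cubic_mul_exp_neg_le_six hc.le) hK0
    _ = 12 * b ^ 3 / (c ^ 4 * Real.log b) := by rw [hK]; ring
end

section
/- Let b > 1 and c > 0 be real numbers. Then ∫_{1}^{∞} b^{x+1}·exp( −c·b^{(x−1)/2} ) dx ≤ 2·b² / (c²·log b). -/
open Filter Topology in
theorem tendsto_add_one_mul_exp_neg_atTop_nhds_zero :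
    Tendsto (fun v : ℝ => (v + 1) * Real.exp (-v)) atTop (𝓝 0) := by
  have h := (Real.tendsto_pow_mul_exp_neg_atTop_nhds_zero 1).add
    (Real.tendsto_pow_mul_exp_neg_atTop_nhds_zero 0)
  simpa [add_mul] using h

theorem hasDerivAt_add_one_mul_exp_neg (v : ℝ) :
    HasDerivAt (fun v : ℝ => (v + 1) * Real.exp (-v)) (-(v * Real.exp (-v))) v := by
  refine (((hasDerivAt_id v).add_const 1).mul (hasDerivAt_neg v).exp).congr_deriv ?_
  simp only [id]
  ring

open Filter Topology in
theorem integral_Ioi_rpow_mul_exp_neg_mul_rpow (b c : ℝ) (hb : 1 < b) (hc : 0 < c) :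
    ∫ x in Set.Ioi (1 : ℝ), b ^ (x + 1) * Real.exp (-c * b ^ ((x - 1) / 2)) =
      2 * b ^ 2 / (c ^ 2 * Real.log b) * ((c + 1) * Real.exp (-c)) := by
  have hb0 : 0 < b := zero_lt_one.trans hb
  have hlog : 0 < Real.log b := Real.log_pos hb
  have hderiv (x : ℝ) : HasDerivAt
      (fun x : ℝ => -(2 * b ^ 2 / (c ^ 2 * Real.log b)) *
        ((c * b ^ ((x - 1) / 2) + 1) * Real.exp (-(c * b ^ ((x - 1) / 2)))))
      (b ^ (x + 1) * Real.exp (-c * b ^ ((x - 1) / 2))) x := by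
    have hu : HasDerivAt (fun x : ℝ => c * b ^ ((x - 1) / 2))
        (c * (Real.log b * (1 / 2) * b ^ ((x - 1) / 2))) x :=
      ((((hasDerivAt_id x).sub_const 1).div_const 2).const_rpow hb0).const_mul c
    have hpow : b ^ (x + 1) = b ^ 2 * (b ^ ((x - 1) / 2)) ^ 2 := by
      rw [← Real.rpow_natCast, ← Real.rpow_natCast, ← Real.rpow_mul hb0.le,
        ← Real.rpow_add hb0]
      congr 1
      push_cast
      ring
    refine (((hasDerivAt_add_one_mul_exp_neg _).comp x hu).const_mul
      (-(2 * b ^ 2 / (c ^ 2 * Real.log b)))).congr_deriv ?_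
    rw [hpow, neg_mul]
    field_simp
  have hexp : Tendsto (fun x : ℝ => c * b ^ ((x - 1) / 2)) atTop atTop := by
    refine Tendsto.const_mul_atTop hc ((tendsto_rpow_atTop_of_base_gt_one b hb).comp ?_)
    exact (tendsto_atTop_add_const_right _ (-1) tendsto_id).atTop_div_const two_pos
  have hlim := (tendsto_add_one_mul_exp_neg_atTop_nhds_zero.comp hexp).const_mul
    (-(2 * b ^ 2 / (c ^ 2 * Real.log b)))
  rw [MeasureTheory.integral_Ioi_of_hasDerivAt_of_nonneg' (fun x _ => hderiv x)
    (fun x _ => by positivity) hlim]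
  simp

/-- Key integral estimate of Theorem 3 (single agent):
`∫_{1}^{∞} b^{x+1}·exp(−c·b^{(x−1)/2}) dx ≤ 2 b²/(c² log b)` for `b > 1`, `c > 0`. -/
theorem stmt15 (b c : ℝ) (hb : 1 < b) (hc : 0 < c) :
    ∫ x in Set.Ioi (1 : ℝ), b ^ (x + 1) * Real.exp (-c * b ^ ((x - 1) / 2)) ≤
      2 * b ^ 2 / (c ^ 2 * Real.log b) := by
  have hlog : 0 < Real.log b := Real.log_pos hb
  rw [integral_Ioi_rpow_mul_exp_neg_mul_rpow b c hb hc]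
  refine mul_le_of_le_one_right (by positivity) ?_
  rw [Real.exp_neg, ← div_eq_mul_inv]
  exact div_le_one_of_le₀ (Real.add_one_le_exp c) (Real.exp_pos c).le
end
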